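/- Let K be a finite simplicial complex of dimension d over a field k of characteristic p > 0 and R = R_K its face ring. Then the Hilbert–Kunz multiplicity e_HK(R) = lim_{q→∞} HK_R(q)/q^{dim R} equals f_d, the number of top-dimensional (d-dimensional) faces of K. -/

import Mathlib

open MvPolynomial Filter

/-- The Stanley–Reisner ideal of a finite simplicial complex `L` on vertices `Fin n`. -/
noncomputable def SRIdeal (k : Type*) [Field k] (n : ℕ)
    (L : Finset (Finset (Fin n))) : Ideal (MvPolynomial (Fin n) k) :=
  Ideal.span {f | ∃ S : Finset (Fin n), S ∉ L ∧ f = ∏ i ∈ S, X i}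

/-- The face ring `R_K = k[x_1,…,x_n]/I_K`. -/
noncomputable abbrev FaceRing (k : Type*) [Field k] (n : ℕ)
    (L : Finset (Finset (Fin n))) : Type _ :=
  MvPolynomial (Fin n) k ⧸ SRIdeal k n L

/-- If a monomial ideal has exactly the finitely many standard monomials `A`, then its quotient
has dimension `#A`. -/
theorem finrank_quotient_span_monomial {k ι : Type*} [Field k] (G : Set (ι →₀ ℕ))
    (A : Finset (ι →₀ ℕ)) (hA : ∀ m, m ∈ A ↔ ¬ ∃ g ∈ G, g ≤ m) :
    Module.finrank k (MvPolynomial ι k ⧸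
      Ideal.span ((fun s => monomial s (1 : k)) '' G)) = A.card := by
  classical
  set I : Ideal (MvPolynomial ι k) := Ideal.span ((fun s => monomial s (1 : k)) '' G) with hI
  let φ : MvPolynomial ι k →ₗ[k] (A → k) := LinearMap.pi fun a => lcoeff k a.1
  have hφ : ∀ f a, φ f a = coeff a.1 f := fun f a => rfl
  have hsurj : Function.Surjective φ := by
    intro c
    refine ⟨∑ a : A, monomial a.1 (c a), funext fun b => ?_⟩
    simp [hφ, coeff_sum, coeff_monomial]
  have hker : I.restrictScalars k = LinearMap.ker φ := by
    ext f
    rw [Submodule.restrictScalars_mem, hI, mem_ideal_span_monomial_image, LinearMap.mem_ker,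
      funext_iff]
    constructor
    · rintro h ⟨a, ha⟩
      by_contra hne
      exact (hA a).1 ha (h a (mem_support_iff.2 hne))
    · intro h m hm
      by_contra hne
      exact mem_support_iff.1 hm (h ⟨m, (hA m).2 hne⟩)
  have e₁ : (MvPolynomial ι k ⧸ I) ≃ₗ[k] (MvPolynomial ι k ⧸ I.restrictScalars k) :=
    (Submodule.Quotient.restrictScalarsEquiv k I).symm
  have e₂ := Submodule.quotEquivOfEq _ _ hker
  have e₃ := φ.quotKerEquivOfSurjective hsurj
  rw [(e₁.trans (e₂.trans e₃)).finrank_eq]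
  simp

/-- The Hilbert–Kunz function of a face ring:
`length (R / m^[q]) = ∑ σ ∈ K, (q - 1) ^ #σ`. -/
theorem finrank_faceRing_quotient_span_pow (k : Type*) [Field k] (n : ℕ)
    (K : Finset (Finset (Fin n)))
    (hK : ∀ σ ∈ K, ∀ τ : Finset (Fin n), τ ⊆ σ → τ ∈ K) (q : ℕ) (hq : 0 < q) :
    Module.finrank k ((FaceRing k n K) ⧸
      Ideal.span {f : FaceRing k n K | ∃ i : Fin n,
        f = Ideal.Quotient.mk (SRIdeal k n K) (X i ^ q)}) =
      ∑ σ ∈ K, (q - 1) ^ σ.card := by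
  classical
  let G₁ : Set (Fin n →₀ ℕ) := (fun S : Finset (Fin n) => ∑ i ∈ S, Finsupp.single i 1) ''
    {S | S ∉ K}
  let G₂ : Set (Fin n →₀ ℕ) := Set.range fun i => Finsupp.single i q
  let A : Finset (Fin n →₀ ℕ) := K.biUnion fun σ => σ.finsupp fun _ => Finset.Ioo 0 q
  have hmem : ∀ (σ : Finset (Fin n)) (m : Fin n →₀ ℕ),
      m ∈ σ.finsupp (fun _ => Finset.Ioo 0 q) ↔ m.support = σ ∧ ∀ i, m i < q := by
    intro σ m
    simp only [Finset.mem_finsupp_iff, Finset.mem_Ioo]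
    constructor
    · rintro ⟨hs, h⟩
      refine ⟨hs.antisymm fun i hi => Finsupp.mem_support_iff.2 (h i hi).1.ne', fun i => ?_⟩
      by_cases hi : i ∈ σ
      · exact (h i hi).2
      · rw [Finsupp.notMem_support_iff.1 fun h' => hi (hs h')]
        exact hq
    · rintro ⟨rfl, h⟩
      exact ⟨subset_rfl, fun i hi => ⟨Nat.pos_of_ne_zero (Finsupp.mem_support_iff.1 hi), h i⟩⟩
  have hle : ∀ (S : Finset (Fin n)) (m : Fin n →₀ ℕ),
      ∑ i ∈ S, Finsupp.single i 1 ≤ m ↔ S ⊆ m.support := by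
    intro S m
    simp only [Finsupp.le_def, Finsupp.finsetSum_apply, Finsupp.single_apply,
      Finset.sum_ite_eq', Finset.subset_iff, Finsupp.mem_support_iff]
    refine forall_congr' fun i => ?_
    split_ifs with h <;> simp [h, Nat.one_le_iff_ne_zero]
  have hA : ∀ m, m ∈ A ↔ ¬ ∃ g ∈ G₁ ∪ G₂, g ≤ m := by
    intro m
    have hmA : m ∈ A ↔ m.support ∈ K ∧ ∀ i, m i < q := by
      simp [A, hmem]
    rw [hmA]
    constructor
    · rintro ⟨hs, hm⟩ ⟨g, ⟨S, hS, rfl⟩ | ⟨i, rfl⟩, hg⟩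
      · exact hS (hK _ hs _ ((hle S m).1 hg))
      · exact (hm i).not_ge (Finsupp.single_le_iff.1 hg)
    · intro h
      refine ⟨?_, fun i => ?_⟩
      · by_contra hs
        exact h ⟨_, Or.inl ⟨_, hs, rfl⟩, (hle _ m).2 subset_rfl⟩
      · by_contra hi
        exact h ⟨_, Or.inr ⟨i, rfl⟩, Finsupp.single_le_iff.2 (not_lt.1 hi)⟩
  have hcard : A.card = ∑ σ ∈ K, (q - 1) ^ σ.card := by
    rw [Finset.card_biUnion]
    · simp [Finset.card_finsupp]
    · intro σ _ τ _ hne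
      refine Finset.disjoint_left.2 fun m h₁ h₂ => hne ?_
      rw [← ((hmem _ _).1 h₁).1, ((hmem _ _).1 h₂).1]
  have hSR : SRIdeal k n K = Ideal.span ((fun s => monomial s (1 : k)) '' G₁) := by
    rw [SRIdeal, Set.image_image]
    congr 1
    ext f
    simp only [Set.mem_ofPred_eq, Set.mem_image, monomial_sum_one, eq_comm (a := f)]
    simp only [X]
  let J : Ideal (MvPolynomial (Fin n) k) := Ideal.span ((fun s => monomial s (1 : k)) '' G₂)
  have hJ : Ideal.span {f : FaceRing k n K | ∃ i : Fin n,
      f = Ideal.Quotient.mk (SRIdeal k n K) (X i ^ q)} =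
      J.map (Ideal.Quotient.mkₐ k (SRIdeal k n K)) := by
    rw [Ideal.map_span]
    congr 1
    ext f
    simp [G₂, X_pow_eq_monomial, eq_comm]
  rw [hJ, ← hcard, ← finrank_quotient_span_monomial (k := k) _ A hA, Set.image_union,
    Ideal.span_union, ← hSR]
  exact (DoubleQuot.quotQuotEquivQuotSupₐ k (SRIdeal k n K) J).toLinearEquiv.finrank_eq

/-- The Hilbert–Kunz multiplicity of a face ring of a `d`-dimensional complex `K`,
`e_HK(R) = lim_{q→∞} HK_R(q)/q^{dim R}` (with `q = p^r`, `dim R = d + 1`), equals the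
number of `d`-dimensional faces of `K`. -/
theorem stmt15 (k : Type*) [Field k] (p : ℕ) [Fact p.Prime] [CharP k p]
    (n : ℕ) (K : Finset (Finset (Fin n)))
    (hK : ∀ σ ∈ K, ∀ τ : Finset (Fin n), τ ⊆ σ → τ ∈ K)
    (d : ℕ) (hd : ∀ σ ∈ K, σ.card ≤ d + 1) (hd' : ∃ σ ∈ K, σ.card = d + 1) :
    Tendsto (fun r : ℕ =>
        (Module.finrank k ((FaceRing k n K) ⧸
            Ideal.span {f : FaceRing k n K | ∃ i : Fin n,
              f = Ideal.Quotient.mk (SRIdeal k n K) (X i ^ p ^ r)}) : ℝ) /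
          ((p : ℝ) ^ r) ^ (d + 1))
      atTop (nhds ((K.filter (fun σ => σ.card = d + 1)).card : ℝ)) := by
  have hp : 1 < p := (Fact.out : p.Prime).one_lt
  have hp0 : (p : ℝ) ≠ 0 := by positivity
  have hlim : Tendsto (fun r : ℕ => ((p : ℝ) ^ r)⁻¹) atTop (nhds 0) :=
    (tendsto_pow_atTop_atTop_of_one_lt (by exact_mod_cast hp)).inv_tendsto_atTop
  have hsum : Tendsto (fun r : ℕ => ∑ σ ∈ K,
      (1 - ((p : ℝ) ^ r)⁻¹) ^ σ.card * (((p : ℝ) ^ r)⁻¹) ^ (d + 1 - σ.card)) atTop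
      (nhds (∑ σ ∈ K, (1 - (0 : ℝ)) ^ σ.card * 0 ^ (d + 1 - σ.card))) :=
    tendsto_finsetSum _ fun σ _ => ((hlim.const_sub 1).pow _).mul (hlim.pow _)
  convert hsum using 1
  · funext r
    rw [finrank_faceRing_quotient_span_pow k n K hK (p ^ r) (by positivity), Nat.cast_sum,
      Finset.sum_div]
    refine Finset.sum_congr rfl fun σ hσ => ?_
    obtain ⟨c, hc⟩ := Nat.exists_eq_add_of_le (hd σ hσ)
    have hq : (p : ℝ) ^ r ≠ 0 := pow_ne_zero _ hp0
    rw [hc, Nat.add_sub_cancel_left, Nat.cast_pow, Nat.cast_pred (by positivity), Nat.cast_pow,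
      pow_add, inv_pow, show 1 - ((p : ℝ) ^ r)⁻¹ = ((p : ℝ) ^ r - 1) / (p : ℝ) ^ r by
        field_simp, div_pow]
    field_simp
  · congr 1
    rw [Finset.card_filter, Nat.cast_sum]
    refine Finset.sum_congr rfl fun σ hσ => ?_
    have := hd σ hσ
    split_ifs with h
    · simp [h]
    · simp [zero_pow (show d + 1 - σ.card ≠ 0 by omega)]
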